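/- Let K be a compact Hausdorff space with the Grothendieck property and let ⟨μ_n⟩ be a Josefson–Nissenzweig sequence on K. For each n write μ_n = ν_n + θ_n, where ν_n is a countably supported signed Radon measure and θ_n is a non-atomic signed Radon measure (θ_n({x}) = 0 for every x ∈ K). Then ‖ν_n‖ → 0 as n → ∞, equivalently ‖θ_n‖ → 1. -/

import Mathlib

open MeasureTheory Filter Topology Set
open scoped ENNReal

namespace JNP

variable {K : Type*} [TopologicalSpace K] [MeasurableSpace K] [BorelSpace K]

/-- The total variation norm of a signed Borel measure. -/
noncomputable def tvNorm (μ : SignedMeasure K) : ℝ :=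
  (μ.totalVariation Set.univ).toReal

/-- A signed Borel measure is Radon if its total variation is a regular measure. -/
def IsRadon (μ : SignedMeasure K) : Prop :=
  μ.totalVariation.Regular

/-- The integral of a function against a signed measure. -/
noncomputable def integ (μ : SignedMeasure K) (f : K → ℝ) : ℝ :=
  ∫ x, f x ∂μ.toJordanDecomposition.posPart -
    ∫ x, f x ∂μ.toJordanDecomposition.negPart

/-- The support of a signed measure: the set of points all of whose open
neighbourhoods have nonzero total variation. -/
def msupport (μ : SignedMeasure K) : Set K :=
  {x : K | ∀ U : Set K, IsOpen U → x ∈ U → μ.totalVariation U ≠ 0}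

/-- Weak* convergence of a sequence of signed measures: convergence of the integrals of
every continuous real-valued function. -/
def WeakStarTendsto (μs : ℕ → SignedMeasure K) (μ : SignedMeasure K) : Prop :=
  ∀ f : C(K, ℝ), Tendsto (fun n => integ (μs n) f) atTop (𝓝 (integ μ f))

/-- A sequence of signed measures is weak* null if the integral of every continuous
real-valued function tends to `0`. -/
def WeakStarNull (μs : ℕ → SignedMeasure K) : Prop :=
  ∀ f : C(K, ℝ), Tendsto (fun n => integ (μs n) f) atTop (𝓝 (0 : ℝ))

/-- Weak convergence of a sequence of signed measures: convergence under every bounded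
linear functional on the Banach space of signed measures with the total variation norm
(which, for Radon measures, is `C(K)*` by the Riesz representation theorem). -/
def WeakTendsto (μs : ℕ → SignedMeasure K) (μ : SignedMeasure K) : Prop :=
  ∀ φ : SignedMeasure K →ₗ[ℝ] ℝ,
    (∃ C : ℝ, ∀ ν : SignedMeasure K, |φ ν| ≤ C * tvNorm ν) →
    Tendsto (fun n => φ (μs n)) atTop (𝓝 (φ μ))

variable (K) in
/-- The Grothendieck property: every weak* convergent sequence of signed Radon measures
is weakly convergent. -/
def GrothendieckProp : Prop :=
  ∀ (μs : ℕ → SignedMeasure K) (μ : SignedMeasure K),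
    (∀ n, IsRadon (μs n)) → IsRadon μ → WeakStarTendsto μs μ → WeakTendsto μs μ

variable (K) in
/-- The ℓ₁-Grothendieck property: every weak* convergent sequence of countably supported
signed Radon measures is weakly convergent. -/
def Ell1Grothendieck : Prop :=
  ∀ (μs : ℕ → SignedMeasure K) (μ : SignedMeasure K),
    (∀ n, IsRadon (μs n)) → (∀ n, (msupport (μs n)).Countable) →
    IsRadon μ → WeakStarTendsto μs μ → WeakTendsto μs μ

variable (K) in
/-- The Δ-Grothendieck property: every weak* convergent sequence of finitely supported
signed Radon measures is weakly convergent. -/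
def DeltaGrothendieck : Prop :=
  ∀ (μs : ℕ → SignedMeasure K) (μ : SignedMeasure K),
    (∀ n, IsRadon (μs n)) → (∀ n, (msupport (μs n)).Finite) →
    IsRadon μ → WeakStarTendsto μs μ → WeakTendsto μs μ

variable (K) in
/-- The finitely supported Josefson–Nissenzweig property: there is a weak* null sequence of
finitely supported signed Radon measures of total variation norm one. -/
def fsJNP : Prop :=
  ∃ μs : ℕ → SignedMeasure K,
    (∀ n, IsRadon (μs n)) ∧ (∀ n, (msupport (μs n)).Finite) ∧
    (∀ n, tvNorm (μs n) = 1) ∧ WeakStarNull μs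

variable (K) in
/-- The countably supported Josefson–Nissenzweig property: there is a weak* null sequence of
countably supported signed Radon measures of total variation norm one. -/
def csJNP : Prop :=
  ∃ μs : ℕ → SignedMeasure K,
    (∀ n, IsRadon (μs n)) ∧ (∀ n, (msupport (μs n)).Countable) ∧
    (∀ n, tvNorm (μs n) = 1) ∧ WeakStarNull μs

end JNP

namespace JNP

/-- Uniform version of the Schur property: pointwise null sequences of finitely additive set
functions that are continuous on the Cantor cube are uniformly null. -/
theorem eventually_forall_abs_le_of_tendsto_zero {ι : Type*} (f : ℕ → Set ι → ℝ)
    (hadd : ∀ n A B, Disjoint A B → f n (A ∪ B) = f n A + f n B)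
    (hcont : ∀ n, Continuous fun ω : ι → Bool => f n {i | ω i = true})
    (hf : ∀ A, Tendsto (fun n => f n A) atTop (𝓝 0)) {ε : ℝ} (hε : 0 < ε) :
    ∀ᶠ n in atTop, ∀ A, |f n A| ≤ ε := by
  classical
  have hδ : 0 < ε / 3 := by positivity
  have hsmall : ∀ A, ∀ᶠ n in atTop, |f n A| ≤ ε / 3 := fun A => by
    filter_upwards [(hf A).eventually (Metric.ball_mem_nhds 0 hδ)] with n hn
    have : |f n A| < ε / 3 := by simpa [Real.dist_eq] using hn
    exact this.le
  obtain ⟨N, ω₀, hω₀⟩ := nonempty_interior_of_iUnion_of_closed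
    (f := fun N : ℕ => ⋂ n ≥ N, {ω : ι → Bool | |f n {i | ω i = true}| ≤ ε / 3})
    (fun N => isClosed_biInter fun n _ => isClosed_le (hcont n).abs continuous_const) <| by
      refine eq_univ_of_forall fun ω => mem_iUnion.2 ?_
      obtain ⟨N, hN⟩ := eventually_atTop.1 (hsmall {i | ω i = true})
      exact ⟨N, mem_iInter₂.2 hN⟩
  obtain ⟨I, u, hu, hIu⟩ := isOpen_pi_iff.1 isOpen_interior ω₀ hω₀
  have hbig : ∀ n ≥ N, ∀ A : Set ι, (∀ i ∈ I, i ∈ A ↔ ω₀ i = true) → |f n A| ≤ ε / 3 := by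
    intro n hn A hA
    have hmem : (fun i => decide (i ∈ A)) ∈ (I : Set ι).pi u := fun i hi => by
      have : decide (i ∈ A) = ω₀ i := by
        rw [Bool.eq_iff_iff, decide_eq_true_iff]
        exact hA i hi
      simpa only [this] using (hu i hi).2
    simpa using mem_iInter₂.1 (interior_subset (hIu hmem)) n hn
  have hfin : ∀ᶠ n in atTop, ∀ J ∈ I.powerset, |f n (J : Set ι)| ≤ ε / 3 :=
    (Filter.eventually_all_finset _).2 fun J _ => hsmall J
  filter_upwards [hfin, eventually_ge_atTop N] with n hn hN A
  set D : Finset ι := I.filter (fun i => ω₀ i = true)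
  set J : Finset ι := I.filter (fun i => i ∈ A)
  have hA : f n A = f n J + f n (A \ I) := by
    rw [← hadd]
    · congr 1
      ext i
      simp only [J, Finset.coe_filter, mem_union, mem_ofPred_eq, Set.mem_sdiff, Finset.mem_coe]
      tauto
    · refine Set.disjoint_left.2 fun i hi hi' => hi'.2 ?_
      exact Finset.filter_subset _ _ hi
  have hD : f n (D ∪ A \ I) = f n D + f n (A \ I) :=
    hadd _ _ _ (Set.disjoint_left.2 fun i hi hi' => hi'.2 (Finset.filter_subset _ _ hi))
  have h₁ := abs_le.1 (hn J (Finset.mem_powerset.2 (Finset.filter_subset _ _)))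
  have h₂ := abs_le.1 (hn D (Finset.mem_powerset.2 (Finset.filter_subset _ _)))
  have h₃ := abs_le.1 <| hbig n hN (D ∪ A \ I) fun i hi => by
    simp [D, hi]
  rw [abs_le]
  constructor <;> linarith [h₁.1, h₁.2, h₂.1, h₂.2, h₃.1, h₃.2]

section

variable {K : Type*} [MeasurableSpace K]

theorem hasSum_indicator_singleton [MeasurableSingletonClass K]
    (ν : SignedMeasure K) {S : Set K} [Countable S] (A : Set S) :
    HasSum (A.indicator fun i => ν {i.1}) (ν (Subtype.val '' A)) := by
  classical
  have h := ν.hasSum_of_disjoint_iUnion (f := fun i : S => if i ∈ A then {i.1} else ∅)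
    (fun i => by split_ifs <;> simp)
    (fun i j hij => by
      have : i.1 ≠ j.1 := fun h => hij (Subtype.ext h)
      simp only [Function.onFun]
      split_ifs <;> simp [this])
  convert! h using 1
  · ext i
    by_cases hi : i ∈ A <;> simp [hi]
  · congr 1
    ext x
    simp

theorem continuous_apply_image_val [MeasurableSingletonClass K]
    (ν : SignedMeasure K) {S : Set K} [Countable S] :
    Continuous fun ω : S → Bool => ν (Subtype.val '' {i | ω i = true}) := by
  classical
  have hs : Summable fun i : S => |ν {i.1}| := by
    simpa using (hasSum_indicator_singleton ν (univ : Set S)).summable.abs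
  simp_rw [← (hasSum_indicator_singleton ν _).tsum_eq]
  refine continuous_tsum (fun i => ?_) hs fun i ω => ?_
  · have : (fun ω : S → Bool => {i | ω i = true}.indicator (fun i : S => ν {i.1}) i) =
        (fun b : Bool => if b = true then ν {i.1} else 0) ∘ fun ω => ω i := by
      ext ω
      simp [Set.indicator_apply]
    rw [this]
    exact continuous_of_discreteTopology.comp (continuous_apply i)
  · rw [Set.indicator_apply]
    split_ifs <;> simp

theorem apply_eq_zero_of_countable [MeasurableSingletonClass K] {θ : SignedMeasure K}
    (hθ : ∀ x, θ {x} = 0) {S : Set K}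
    (hS : S.Countable) : θ S = 0 := by
  have := hS.to_subtype
  simpa [hθ] using (hasSum_indicator_singleton θ (univ : Set S)).tsum_eq.symm

theorem abs_apply_le_tvNorm (μ : SignedMeasure K) (A : Set K) : |μ A| ≤ tvNorm μ :=
  (μ.norm_le_totalVariation A).trans (measureReal_mono (subset_univ A))

theorem exists_tvNorm_eq (μ : SignedMeasure K) :
    ∃ P, MeasurableSet P ∧ tvNorm μ = μ P - μ Pᶜ := by
  obtain ⟨P, hP, hP₁, hP₂, hpos, hneg⟩ := μ.toJordanDecomposition_spec
  refine ⟨P, hP, ?_⟩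
  change μ.totalVariation.real univ = _
  rw [SignedMeasure.totalVariation, measureReal_add_apply, hpos, hneg,
    SignedMeasure.toMeasureOfZeroLE_real_apply _ hP₁ hP MeasurableSet.univ,
    SignedMeasure.toMeasureOfLEZero_real_apply _ hP₂ hP.compl MeasurableSet.univ]
  simp [sub_eq_add_neg]

theorem tvNorm_neg (μ : SignedMeasure K) : tvNorm (-μ) = tvNorm μ := by
  rw [tvNorm, tvNorm, SignedMeasure.totalVariation_neg]

theorem abs_apply_add_abs_apply_compl_le (μ : SignedMeasure K) {P : Set K}
    (hP : MeasurableSet P) : |μ P| + |μ Pᶜ| ≤ tvNorm μ := by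
  refine (add_le_add (μ.norm_le_totalVariation P) (μ.norm_le_totalVariation Pᶜ)).trans_eq ?_
  exact measureReal_add_measureReal_compl hP

theorem tvNorm_add_le (μ ν : SignedMeasure K) : tvNorm (μ + ν) ≤ tvNorm μ + tvNorm ν := by
  obtain ⟨P, hP, h⟩ := exists_tvNorm_eq (μ + ν)
  have hμ := abs_apply_add_abs_apply_compl_le μ hP
  have hν := abs_apply_add_abs_apply_compl_le ν hP
  rw [h, add_apply, add_apply]
  linarith [le_abs_self (μ P), neg_abs_le (μ Pᶜ), le_abs_self (ν P), neg_abs_le (ν Pᶜ)]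

/-- Evaluation of signed measures at a set, as a linear functional. -/
def evalAt (A : Set K) : SignedMeasure K →ₗ[ℝ] ℝ where
  toFun μ := μ A
  map_add' _ _ := rfl
  map_smul' _ _ := rfl

/-- A setwise null sequence of signed measures concentrated on one countable set is norm null. -/
theorem tendsto_tvNorm_zero_of_countable [MeasurableSingletonClass K] {νs : ℕ → SignedMeasure K}
    {S : Set K} (hS : S.Countable) (hνS : ∀ n A, MeasurableSet A → νs n (A ∩ S) = νs n A)
    (hν : ∀ A ⊆ S, Tendsto (fun n => νs n A) atTop (𝓝 0)) :
    Tendsto (fun n => tvNorm (νs n)) atTop (𝓝 0) := by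
  have := hS.to_subtype
  have hmeas : ∀ A : Set S, MeasurableSet (Subtype.val '' A) := fun A =>
    (A.to_countable.image _).measurableSet
  refine Metric.tendsto_nhds.2 fun ε hε => ?_
  have hsmall := eventually_forall_abs_le_of_tendsto_zero
    (fun n (A : Set S) => νs n (Subtype.val '' A))
    (fun n A B hAB => by
      rw [image_union]
      exact VectorMeasure.of_union ((disjoint_image_iff Subtype.val_injective).2 hAB)
        (hmeas A) (hmeas B))
    (fun n => continuous_apply_image_val (νs n))
    (fun A => hν _ (by simp)) (ε := ε / 3) (by positivity)
  filter_upwards [hsmall] with n hn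
  have hle : ∀ A, MeasurableSet A → |νs n A| ≤ ε / 3 := fun A hA => by
    rw [← hνS n A hA, inter_comm, ← Subtype.image_preimage_coe]
    exact hn _
  obtain ⟨P, hP, h⟩ := exists_tvNorm_eq (νs n)
  have h₁ := hle P hP
  have h₂ := hle Pᶜ hP.compl
  have h₀ : 0 ≤ tvNorm (νs n) := ENNReal.toReal_nonneg
  rw [Real.dist_eq, sub_zero, abs_of_nonneg h₀, h]
  linarith [le_abs_self (νs n P), neg_abs_le (νs n Pᶜ)]

end

variable {K : Type*} [TopologicalSpace K] [MeasurableSpace K]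

theorem totalVariation_compl_msupport {μ : SignedMeasure K} (hμ : IsRadon μ) :
    μ.totalVariation (msupport μ)ᶜ = 0 := by
  have : μ.totalVariation.Regular := hμ
  have hnull : ∀ x ∈ (msupport μ)ᶜ, ∃ U, IsOpen U ∧ x ∈ U ∧ μ.totalVariation U = 0 := by
    intro x hx
    simpa [msupport] using hx
  have hopen : IsOpen (msupport μ)ᶜ := by
    refine isOpen_iff_forall_mem_open.2 fun x hx => ?_
    obtain ⟨U, hU, hxU, hU0⟩ := hnull x hx
    exact ⟨U, fun y hy hy' => hy' U hU hy hU0, hU, hxU⟩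
  rw [hopen.measure_eq_iSup_isCompact]
  simp only [ENNReal.iSup_eq_zero]
  refine fun C hC hCc => hCc.measure_zero_of_nhdsWithin fun x hx => ?_
  obtain ⟨U, hU, hxU, hU0⟩ := hnull x (hC hx)
  exact ⟨U, mem_nhdsWithin_of_mem_nhds (hU.mem_nhds hxU), hU0⟩

theorem apply_inter_of_msupport_subset {μ : SignedMeasure K} (hμ : IsRadon μ) {S A : Set K}
    (hS : MeasurableSet S) (hμS : msupport μ ⊆ S) (hA : MeasurableSet A) :
    μ (A ∩ S) = μ A := by
  have h0 : μ (A \ S) = 0 := μ.null_of_totalVariation_zero <|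
    measure_mono_null (fun x hx hx' => hx.2 (hμS hx')) (totalVariation_compl_msupport hμ)
  conv_rhs => rw [← inter_union_sdiff A S]
  rw [VectorMeasure.of_union disjoint_sdiff_inter.symm (hA.inter hS) (hA.diff hS), h0, add_zero]

theorem GrothendieckProp.tendsto_apply (hG : GrothendieckProp K) {μs : ℕ → SignedMeasure K}
    (hrad : ∀ n, IsRadon (μs n)) (hnull : WeakStarNull μs) (A : Set K) :
    Tendsto (fun n => μs n A) atTop (𝓝 0) := by
  have h0 : IsRadon (0 : SignedMeasure K) := by
    rw [IsRadon, SignedMeasure.totalVariation_zero]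
    infer_instance
  have := hG μs 0 hrad h0 (fun f => by
      simpa [integ, SignedMeasure.toJordanDecomposition_zero] using hnull f) (evalAt A)
    ⟨1, fun ν => by simpa using! abs_apply_le_tvNorm ν A⟩
  exact this

end JNP

/-- If `K` has the Grothendieck property and `⟨μ_n⟩` is a Josefson–Nissenzweig sequence on `K`
with `μ_n = ν_n + θ_n`, where `ν_n` is countably supported and `θ_n` is non-atomic, then
`‖ν_n‖ → 0`, equivalently `‖θ_n‖ → 1`. -/
theorem stmt_10 (K : Type*) [TopologicalSpace K] [MeasurableSpace K] [BorelSpace K]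
    [CompactSpace K] [T2Space K] (hG : JNP.GrothendieckProp K)
    (μs νs θs : ℕ → MeasureTheory.SignedMeasure K)
    (hrad : ∀ n, JNP.IsRadon (μs n)) (hnorm : ∀ n, JNP.tvNorm (μs n) = 1)
    (hnull : JNP.WeakStarNull μs)
    (hdecomp : ∀ n, μs n = νs n + θs n)
    (hνrad : ∀ n, JNP.IsRadon (νs n)) (hνsupp : ∀ n, (JNP.msupport (νs n)).Countable)
    (hθrad : ∀ n, JNP.IsRadon (θs n)) (hθna : ∀ n, ∀ x : K, θs n {x} = 0) :
    Filter.Tendsto (fun n => JNP.tvNorm (νs n)) Filter.atTop (nhds 0) ∧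
    Filter.Tendsto (fun n => JNP.tvNorm (θs n)) Filter.atTop (nhds 1) := by
  have hS : (⋃ n, JNP.msupport (νs n)).Countable := countable_iUnion hνsupp
  have hν : Tendsto (fun n => JNP.tvNorm (νs n)) atTop (𝓝 0) := by
    refine JNP.tendsto_tvNorm_zero_of_countable hS
      (fun n A hA => JNP.apply_inter_of_msupport_subset (hνrad n) hS.measurableSet
        (subset_iUnion (fun n => JNP.msupport (νs n)) n) hA) fun A hA => ?_
    refine (hG.tendsto_apply hrad hnull A).congr fun n => ?_
    rw [hdecomp, add_apply,
      JNP.apply_eq_zero_of_countable (hθna n) (hS.mono hA), add_zero]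
  refine ⟨hν, ?_⟩
  refine tendsto_iff_dist_tendsto_zero.2 (squeeze_zero (fun _ => dist_nonneg) (fun n => ?_) hν)
  have h₁ := JNP.tvNorm_add_le (νs n) (θs n)
  have h₂ := JNP.tvNorm_add_le (μs n) (-νs n)
  rw [JNP.tvNorm_neg, show μs n + -νs n = θs n by rw [hdecomp]; abel, hnorm] at h₂
  rw [← hdecomp, hnorm] at h₁
  rw [Real.dist_eq, abs_le]
  constructor <;> linarith
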